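/- arXiv:1509.09296 — 2 statements merged into one kernel-verified Lean document; each statement's English description precedes it below -/
import Mathlib

section
/- Let (X, τ) be a T1 topological space with no isolated points. For x ∈ X, let Ω_x denote the family of subsets A of X \ {x} such that x lies in the closure of A; let 𝔇 denote the family of dense subsets of X; and call a subset A of X discrete if every point of X has an open neighborhood meeting A in at most one point, with 𝔑𝔇 the family of non-discrete subsets of X. If player ONE has a winning strategy in the game G₁(𝔇, 𝔑𝔇) on X, then at each point x ∈ X player ONE has a winning strategy in the game G₁(Ω_x, Ω_x). -/
/-- A strategy for player ONE in the game `G₁(𝒜, ℬ)`: it assigns to each finite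
sequence of previous moves by TWO a set (intended to be a member of `𝒜`). -/
def IsWinningStrategyForOne {X : Type*} (𝒜 ℬ : Set (Set X)) (σ : List X → Set X) : Prop :=
  (∀ s : List X, σ s ∈ 𝒜) ∧
    ∀ f : ℕ → X, (∀ n : ℕ, f n ∈ σ (List.ofFn fun i : Fin n => f i)) →
      Set.range f ∉ ℬ

/-- The selection principle `S₁(𝒜, ℬ)`. -/
def SelectionS1 {X : Type*} (𝒜 ℬ : Set (Set X)) : Prop :=
  ∀ O : ℕ → Set X, (∀ n, O n ∈ 𝒜) →
    ∃ f : ℕ → X, (∀ n, f n ∈ O n) ∧ Set.range f ∈ ℬ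

/-- `Ω_x`: sets `A ⊆ X \ {x}` with `x` in the closure of `A`. -/
def OmegaAt {X : Type*} [TopologicalSpace X] (x : X) : Set (Set X) :=
  {A | A ⊆ {x}ᶜ ∧ x ∈ closure A}

/-- The family of dense subsets of `X`. -/
def DenseFamily (X : Type*) [TopologicalSpace X] : Set (Set X) :=
  {A | Dense A}

/-- `A` is discrete: every point of `X` has an open neighborhood meeting `A`
in at most one point. -/
def IsDiscreteSubset {X : Type*} [TopologicalSpace X] (A : Set X) : Prop :=
  ∀ y : X, ∃ U : Set X, IsOpen U ∧ y ∈ U ∧ (U ∩ A).Subsingleton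

/-- The family of non-discrete subsets of `X`. -/
def NonDiscreteFamily (X : Type*) [TopologicalSpace X] : Set (Set X) :=
  {A | ¬ IsDiscreteSubset A}

/-- In a T1 space with no isolated points, if ONE has a winning
strategy in `G₁(𝔇, 𝔑𝔇)`, then at each `x` ONE has a winning strategy in
`G₁(Ω_x, Ω_x)`. -/
theorem stmt_0 {X : Type*} [TopologicalSpace X] [T1Space X]
    (hni : ∀ x : X, ¬ IsOpen ({x} : Set X))
    (h : ∃ σ : List X → Set X,
      IsWinningStrategyForOne (DenseFamily X) (NonDiscreteFamily X) σ) :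
    ∀ x : X, ∃ σ : List X → Set X,
      IsWinningStrategyForOne (OmegaAt x) (OmegaAt x) σ := by
  intro x
  obtain ⟨σ, hσ, hw⟩ := h
  have hne : ∀ y : X, (nhdsWithin y {y}ᶜ).NeBot := by
    intro y
    rw [Filter.neBot_iff]
    intro hy
    exact hni y (isOpen_singleton_iff_punctured_nhds y |>.2 hy)
  refine ⟨fun s => σ s \ {x}, ?_, ?_⟩
  · intro s
    refine ⟨fun y hy => hy.2, ?_⟩
    have hd : Dense (σ s) := hσ s
    exact (hd.diff_singleton x) x
  · intro f hf hmem
    have hdisc : IsDiscreteSubset (Set.range f) := by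
      by_contra hcon
      exact hw f (fun n => (hf n).1) hcon
    obtain ⟨U, hU, hxU, hsub⟩ := hdisc x
    obtain ⟨hx, hcl⟩ := hmem
    obtain ⟨y, hyU, hyA⟩ := mem_closure_iff.1 hcl U hU hxU
    have hxy : x ≠ y := fun e => hx hyA e.symm
    obtain ⟨z, ⟨hzU, hzy⟩, hzA⟩ := mem_closure_iff.1 hcl (U ∩ {y}ᶜ)
      (hU.inter isOpen_compl_singleton) ⟨hxU, hxy⟩
    exact hzy (hsub ⟨hzU, hzA⟩ ⟨hyU, hyA⟩)
end

section
/- Assume the Continuum Hypothesis. There exists a nonempty T3 (regular Hausdorff) topological space X such that X has countable strong fan tightness at each point x ∈ X (that is, the selection principle S₁(Ω_x, Ω_x) holds at each x), and yet at each point x ∈ X player ONE has a winning strategy in the game G₁(Ω_x, Ω_x). -/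
namespace FanTree

/-- Incomparable nodes of the tree `ω^{<ω}` (nodes grow by `cons`, the order is the suffix order). -/
def Inc (a b : List ℕ) : Prop := ¬ a <:+ b ∧ ¬ b <:+ a

/-- Positive sets: those containing an infinite antichain. -/
def Pos (A : Set (List ℕ)) : Prop := ∃ B ⊆ A, B.Infinite ∧ B.Pairwise Inc

theorem Pos.mono {A B : Set (List ℕ)} (h : A ⊆ B) (hA : Pos A) : Pos B := by
  obtain ⟨C, hC, h1, h2⟩ := hA
  exact ⟨C, hC.trans h, h1, h2⟩

theorem Pos.union {A B : Set (List ℕ)} (h : Pos (A ∪ B)) : Pos A ∨ Pos B := by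
  obtain ⟨C, hC, h1, h2⟩ := h
  have : C = (C ∩ A) ∪ (C ∩ B) := by
    rw [← Set.inter_union_distrib_left]; exact (Set.inter_eq_left.2 hC).symm
  rw [this, Set.infinite_union] at h1
  rcases h1 with h1 | h1
  · exact Or.inl ⟨_, Set.inter_subset_right, h1, h2.mono Set.inter_subset_left⟩
  · exact Or.inr ⟨_, Set.inter_subset_right, h1, h2.mono Set.inter_subset_left⟩

theorem Pos.infinite {A : Set (List ℕ)} (h : Pos A) : A.Infinite := by
  obtain ⟨C, hC, h1, h2⟩ := h
  exact h1.mono hC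

theorem not_pos_of_subsingleton {A : Set (List ℕ)} (h : A.Subsingleton) : ¬ Pos A :=
  fun hp => hp.infinite h.finite

theorem suffix_total {α : Type*} {a b c : List α} (h1 : a <:+ c) (h2 : b <:+ c) :
    a <:+ b ∨ b <:+ a := List.suffix_or_suffix_of_suffix h1 h2

/-- An antichain, almost all of whose elements are comparable to `x`,
has all but finitely many elements above `x`. -/
theorem good_of {A : Set (List ℕ)} (hA : A.Infinite) (hA2 : A.Pairwise Inc) {x y : List ℕ}
    (hxy : Inc x y) : (A ∩ {z | Inc x z}).Infinite ∨ (A ∩ {z | Inc y z}).Infinite := by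
  by_contra hcon
  push Not at hcon
  obtain ⟨h1, h2⟩ := hcon
  have low : ∀ u, (A ∩ {z | z <:+ u}).Subsingleton := by
    intro u a ha b hb
    by_contra hne
    have := hA2 ha.1 hb.1 hne
    rcases suffix_total ha.2 hb.2 with h | h
    · exact this.1 h
    · exact this.2 h
  apply hA
  refine (((h1.union h2).union (low x).finite).union (low y).finite).subset ?_
  intro z hz
  by_contra hn
  simp only [Set.mem_union, Set.mem_inter_iff, Set.mem_setOf_eq, hz, true_and, not_or, Inc,
    not_and, not_not] at hn
  have hxz : x <:+ z := by tauto
  have hyz : y <:+ z := by tauto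
  rcases suffix_total hxz hyz with h | h
  · exact hxy.1 h
  · exact hxy.2 h

/-- Nodes of `A` incomparable to all those recorded in `L`. -/
def Free (L : List (ℕ × List ℕ)) (A : Set (List ℕ)) : Set (List ℕ) :=
  A ∩ {z | ∀ p ∈ L, Inc p.2 z}

/-- The recursion state invariant. -/
def Good (A : ℕ → Set (List ℕ)) (L : List (ℕ × List ℕ)) : Prop :=
  ∀ᶠ m in (Filter.hyperfilter ℕ : Filter ℕ), (Free L (A m)).Infinite

theorem step (A : ℕ → Set (List ℕ)) (hA2 : ∀ n, (A n).Pairwise Inc)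
    (L : List (ℕ × List ℕ)) (hL : Good A L) :
    ∃ q : ℕ × List ℕ, Good A (q :: L) ∧ q.2 ∈ Free L (A q.1) ∧ ∀ p ∈ L, p.1 < q.1 := by
  have hbig : ∀ᶠ m in (Filter.hyperfilter ℕ : Filter ℕ), ∀ p ∈ L, p.1 < m := by
    have : ∀ᶠ m in (Filter.atTop : Filter ℕ), ∀ p ∈ L.toFinset, p.1 < m := by
      rw [Filter.eventually_all_finset]
      intro p _
      exact Filter.eventually_gt_atTop p.1
    have h2 := (Nat.hyperfilter_le_atTop) this
    filter_upwards [h2] with m hm p hp using hm p (List.mem_toFinset.2 hp)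
  obtain ⟨k, hk, hkb⟩ := (hL.and hbig).exists
  obtain ⟨x, hx, y, hy, hne⟩ := hk.nontrivial
  have hinc : Inc x y := hA2 k hx.1 hy.1 hne
  have key : ∀ᶠ m in (Filter.hyperfilter ℕ : Filter ℕ),
      (Free L (A m) ∩ {z | Inc x z}).Infinite ∨ (Free L (A m) ∩ {z | Inc y z}).Infinite := by
    filter_upwards [hL] with m hm
    exact good_of hm ((hA2 m).mono Set.inter_subset_left) hinc
  have hfree : ∀ w m, Free L (A m) ∩ {z | Inc w z} = Free ((k, w) :: L) (A m) := by
    intro w m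
    ext z
    simp only [Free, Set.mem_inter_iff, Set.mem_setOf_eq, List.forall_mem_cons]
    tauto
  rw [Ultrafilter.eventually_or] at key
  rcases key with h | h
  · refine ⟨(k, x), ?_, hx, hkb⟩
    simpa only [Good, hfree] using h
  · refine ⟨(k, y), ?_, hy, hkb⟩
    simpa only [Good, hfree] using h

theorem select (A : ℕ → Set (List ℕ)) (hA : ∀ n, Pos (A n)) :
    ∃ t : ℕ → List ℕ, (∀ n, t n ∈ A n) ∧ Pos (Set.range t) := by
  choose B hBA hBi hBp using hA
  have hstep := step B hBp
  choose q hq1 hq2 hq3 using hstep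
  let st : ℕ → {L // Good B L} := fun n => Nat.rec
    ⟨[], by
      refine Filter.Eventually.of_forall fun m => ?_
      simpa [Free] using hBi m⟩
    (fun _ s => ⟨q s.1 s.2 :: s.1, hq1 s.1 s.2⟩) n
  let h : ℕ → ℕ × List ℕ := fun n => q (st n).1 (st n).2
  have hst : ∀ n, (st (n+1)).1 = h n :: (st n).1 := fun n => rfl
  have hmem : ∀ j i, i < j → h i ∈ (st j).1 := by
    intro j
    induction j with
    | zero => intro i hi; omega
    | succ j ih =>
      intro i hi
      rw [hst]
      rcases Nat.lt_succ_iff_lt_or_eq.1 hi with h1 | h1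
      · exact List.mem_cons_of_mem _ (ih i h1)
      · subst h1; exact List.mem_cons_self
  have hmono : StrictMono fun n => (h n).1 := fun i j hij => hq3 _ (st j).2 _ (hmem j i hij)
  have hinc : ∀ i j, i < j → Inc (h i).2 (h j).2 := fun i j hij =>
    (hq2 _ (st j).2).2 _ (hmem j i hij)
  have hne : ∀ n, ∃ z, z ∈ B n := fun n => (hBi n).nonempty
  choose d hd using hne
  refine ⟨Function.extend (fun n => (h n).1) (fun n => (h n).2) d, ?_, ?_⟩
  · intro n
    by_cases hn : ∃ a, (h a).1 = n
    · obtain ⟨a, rfl⟩ := hn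
      have := hmono.injective.extend_apply (fun n => (h n).2) d a
      rw [this]
      exact hBA _ (hq2 _ (st a).2).1
    · rw [Function.extend_apply' _ _ _ hn]
      exact hBA _ (hd n)
  · have hinj : Function.Injective fun n => (h n).2 := by
      intro i j hij
      by_contra hne
      rcases lt_or_gt_of_ne hne with hl | hl
      · exact (hinc _ _ hl).1 (by simp only at hij; rw [hij])
      · exact (hinc _ _ hl).1 (by simp only at hij; rw [hij])
    refine ⟨Set.range fun n => (h n).2, ?_, Set.infinite_range_of_injective hinj, ?_⟩
    · rintro _ ⟨a, rfl⟩
      exact ⟨(h a).1, hmono.injective.extend_apply (fun n => (h n).2) d a⟩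
    · rintro _ ⟨a, rfl⟩ _ ⟨b, rfl⟩ hab
      have : a ≠ b := by rintro rfl; exact hab rfl
      rcases lt_or_gt_of_ne this with hl | hl
      · exact hinc _ _ hl
      · exact (hinc _ _ hl).symm

/-- The underlying set of the space: finite sequences of nodes. -/
abbrev Pt : Type := List (List ℕ)

/-- The directions at `s` whose cone meets `A`. -/
def pr (s : Pt) (A : Set Pt) : Set (List ℕ) := {t | ∃ r ∈ A, (t :: s) <:+ r}

theorem pr_mono (s : Pt) {A B : Set Pt} (h : A ⊆ B) : pr s A ⊆ pr s B :=
  fun _ ⟨r, hr, h2⟩ => ⟨r, h hr, h2⟩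

/-- `U` is open iff at each of its points, in almost all directions the cone lies in `U`. -/
def topo : TopologicalSpace Pt where
  IsOpen U := ∀ s ∈ U, ¬ Pos (pr s Uᶜ)
  isOpen_univ := by
    intro s _
    apply not_pos_of_subsingleton
    rintro a ⟨r, hr, _⟩
    exact absurd (Set.mem_univ r) hr
  isOpen_inter := by
    intro U V hU hV s hs hp
    have : pr s (U ∩ V)ᶜ ⊆ pr s Uᶜ ∪ pr s Vᶜ := by
      rintro t ⟨r, hr, h⟩
      by_cases hrU : r ∈ U
      · exact Or.inr ⟨r, fun hrV => hr ⟨hrU, hrV⟩, h⟩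
      · exact Or.inl ⟨r, hrU, h⟩
    rcases (hp.mono this).union with h | h
    · exact hU s hs.1 h
    · exact hV s hs.2 h
  isOpen_sUnion := by
    rintro S hS s ⟨U, hU, hs⟩ hp
    refine hS U hU s hs (hp.mono (pr_mono s ?_))
    exact Set.compl_subset_compl.2 (Set.subset_sUnion_of_mem hU)

attribute [local instance] topo

theorem isOpen_def {U : Set Pt} : IsOpen U ↔ ∀ s ∈ U, ¬ Pos (pr s Uᶜ) := Iff.rfl

/-- Basic neighbourhoods. -/
def nb (s : Pt) (B : Set (List ℕ)) : Set Pt := {r | r = s ∨ ∃ t, t ∉ B ∧ (t :: s) <:+ r}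

theorem dir_subsingleton (s r : Pt) : {t : List ℕ | (t :: r) <:+ s}.Subsingleton := by
  intro a ha b hb
  rcases suffix_total (a := a :: r) (b := b :: r) ha hb with h | h
  · have := h.eq_of_length (by simp)
    simpa using this
  · have := h.eq_of_length (by simp)
    simpa using this.symm

theorem not_cons_suffix (t : List ℕ) (s : Pt) : ¬ (t :: s) <:+ s := by
  intro h
  have := h.length_le
  simp at this

theorem nb_open (s : Pt) {B : Set (List ℕ)} (hB : ¬ Pos B) : IsOpen (nb s B) := by
  rw [isOpen_def]
  intro r hr hp
  rcases hr with rfl | ⟨t, ht, h⟩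
  · refine hB (hp.mono ?_)
    rintro t ⟨q, hq, h⟩
    by_contra htB
    exact hq (Or.inr ⟨t, htB, h⟩)
  · refine not_pos_of_subsingleton ?_ hp
    rintro a ⟨q, hq, h2⟩
    exact absurd (Or.inr ⟨t, ht, h.trans ((List.suffix_cons a r).trans h2)⟩) hq

theorem nb_closed (s : Pt) (B : Set (List ℕ)) : IsClosed (nb s B) := by
  rw [← isOpen_compl_iff, isOpen_def]
  intro r hr
  rw [compl_compl]
  refine not_pos_of_subsingleton ((dir_subsingleton s r).anti ?_)
  rintro t ⟨q, hq, h⟩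
  rcases hq with rfl | ⟨u, hu, h2⟩
  · exact h
  · rcases suffix_total h h2 with h3 | h3
    · rcases List.suffix_cons_iff.1 h3 with h4 | h4
      · exact absurd (Or.inl (List.cons.inj h4).2) hr
      · exact h4
    · rcases List.suffix_cons_iff.1 h3 with h4 | h4
      · exact absurd (Or.inl (List.cons.inj h4).2.symm) hr
      · exact absurd (Or.inr ⟨u, hu, h4⟩) hr

theorem t3 : T3Space Pt := by
  have h1 : T1Space Pt := by
    refine ⟨fun s => ?_⟩
    rw [← isOpen_compl_iff, isOpen_def]
    intro r hr
    rw [compl_compl]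
    refine not_pos_of_subsingleton ((dir_subsingleton s r).anti ?_)
    rintro t ⟨q, rfl, h⟩
    exact h
  have h2 : RegularSpace Pt := by
    refine RegularSpace.of_exists_mem_nhds_isClosed_subset fun s V hV => ?_
    obtain ⟨U, hUV, hU, hs⟩ := mem_nhds_iff.1 hV
    refine ⟨nb s (pr s Uᶜ), (nb_open s (hU s hs)).mem_nhds (Or.inl rfl), nb_closed _ _, ?_⟩
    rintro r (rfl | ⟨t, ht, h⟩)
    · exact hUV hs
    · by_contra hr
      exact ht ⟨r, fun hrU => hr (hUV hrU), h⟩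
  exact {}

theorem mem_omega {s : Pt} {A : Set Pt} : A ∈ OmegaAt s ↔ A ⊆ {s}ᶜ ∧ Pos (pr s A) := by
  refine and_congr_right fun hA => ?_
  constructor
  · intro h
    by_contra hp
    obtain ⟨r, hr, hrA⟩ := mem_closure_iff.1 h _ (nb_open s hp) (Or.inl rfl)
    rcases hr with rfl | ⟨t, ht, h2⟩
    · exact hA hrA rfl
    · exact ht ⟨r, hrA, h2⟩
  · intro hp
    rw [mem_closure_iff]
    intro U hU hs
    by_contra hne
    refine hU s hs (hp.mono (pr_mono s ?_))
    intro r hr hrU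
    exact hne ⟨r, hrU, hr⟩

theorem s1 (s : Pt) : SelectionS1 (OmegaAt s) (OmegaAt s) := by
  intro O hO
  obtain ⟨t, ht, hp⟩ := select (fun n => pr s (O n)) fun n => (mem_omega.1 (hO n)).2
  choose f hf hft using ht
  refine ⟨f, hf, mem_omega.2 ⟨?_, hp.mono ?_⟩⟩
  · rintro _ ⟨n, rfl⟩
    exact (mem_omega.1 (hO n)).1 (hf n)
  · rintro _ ⟨n, rfl⟩
    exact ⟨f n, ⟨n, rfl⟩, hft n⟩

/-- The node recorded in the last move of TWO. -/
def lastNode (l : List Pt) : List ℕ := (l.getLast?.getD []).headD []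

/-- ONE plays the children of the last node chosen. -/
def strat (s : Pt) (l : List Pt) : Set Pt := {x | ∃ n : ℕ, x = (n :: lastNode l) :: s}

theorem strat_wins (s : Pt) : IsWinningStrategyForOne (OmegaAt s) (OmegaAt s) (strat s) := by
  constructor
  · intro l
    refine mem_omega.2 ⟨?_, Set.range fun n : ℕ => n :: lastNode l, ?_,
      Set.infinite_range_of_injective ?_, ?_⟩
    · rintro _ ⟨n, rfl⟩ h
      exact not_cons_suffix _ s (by rw [Set.mem_singleton_iff.1 h])
    · rintro _ ⟨n, rfl⟩
      exact ⟨_, ⟨n, rfl⟩, List.suffix_refl _⟩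
    · intro a b hab
      exact (List.cons.inj hab).1
    · rintro _ ⟨a, rfl⟩ _ ⟨b, rfl⟩ hab
      constructor
      · intro h
        exact hab (h.eq_of_length (by simp))
      · intro h
        exact hab (h.eq_of_length (by simp)).symm
  · intro f hf hr
    choose m hm using hf
    have hp := (mem_omega.1 hr).2
    let τ : ℕ → List ℕ := fun n => m n :: lastNode (List.ofFn fun i : Fin n => f i)
    have hfτ : ∀ n, f n = τ n :: s := hm
    have hτ : ∀ n, τ n <:+ τ (n+1) := by
      intro n
      have : lastNode (List.ofFn fun i : Fin (n+1) => f i) = τ n := by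
        rw [List.ofFn_succ']
        simp [lastNode, hfτ n]
      simp only [τ] at this ⊢
      rw [this]
      exact List.suffix_cons _ _
    have hle : ∀ i j, i ≤ j → τ i <:+ τ j := by
      intro i j hij
      induction hij with
      | refl => exact List.suffix_refl _
      | step _ ih => exact ih.trans (hτ _)
    have hsub : pr s (Set.range f) ⊆ Set.range τ := by
      rintro t ⟨_, ⟨n, rfl⟩, h⟩
      rw [hfτ] at h
      refine ⟨n, ?_⟩
      have := h.eq_of_length (by simp)
      exact (List.cons.inj this).1.symm
    obtain ⟨C, hC, hCi, hCp⟩ := hp.mono hsub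
    obtain ⟨x, hx, y, hy, hne⟩ := hCi.nontrivial
    have hinc := hCp hx hy hne
    obtain ⟨i, rfl⟩ := hC hx
    obtain ⟨j, rfl⟩ := hC hy
    rcases le_total i j with h | h
    · exact hinc.1 (hle _ _ h)
    · exact hinc.2 (hle _ _ h)

end FanTree

/-- CH: There is a nonempty T3 space with countable strong fan
tightness at every point, yet ONE has a winning strategy in `G₁(Ω_x, Ω_x)` at
every point. -/
theorem stmt_1 (hCH : Cardinal.continuum = Cardinal.aleph 1) :
    ∃ (X : Type) (_ : TopologicalSpace X), Nonempty X ∧ T3Space X ∧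
      (∀ x : X, SelectionS1 (OmegaAt x) (OmegaAt x)) ∧
      (∀ x : X, ∃ σ : List X → Set X,
        IsWinningStrategyForOne (OmegaAt x) (OmegaAt x) σ) := by
  exact ⟨FanTree.Pt, FanTree.topo, ⟨[]⟩, FanTree.t3, FanTree.s1,
    fun x => ⟨FanTree.strat x, FanTree.strat_wins x⟩⟩
end
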